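/- (Theorem 3.3, second bound, explicit constants.) Let A = M + K with A and M invertible n×n real matrices, b ∈ ℝⁿ with b ≠ 0, x := A⁻¹b, B := I + M⁻¹K, and c := M⁻¹b. Let ε ≥ 0 and suppose x_L ∈ ℝⁿ satisfies ‖c − B·x_L‖ ≤ ε·(‖B‖·‖x_L‖ + 2·‖M⁻¹‖·‖K‖·‖x_L‖) and ‖b − A·x_L‖ ≤ ‖b‖. Then ‖x − x_L‖ ≤ 2ε·κ(B)·(1 + 2·‖A⁻¹‖·‖K‖)·‖A⁻¹‖·‖b‖, i.e. an iterative method for the accurately preconditioned system whose residual converges to the level of the matrix–vector multiplication error achieves inverse-equivalent accuracy. -/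

import Mathlib

open Matrix

/-- Euclidean norm of a vector in `ℝⁿ`. -/
noncomputable def vnorm {n : ℕ} (v : Fin n → ℝ) : ℝ :=
  ‖(WithLp.equiv 2 (Fin n → ℝ)).symm v‖

/-- Operator norm (spectral norm) of a matrix, induced by the Euclidean norm. -/
noncomputable def opnorm {n : ℕ} (A : Matrix (Fin n) (Fin n) ℝ) : ℝ :=
  ‖Matrix.toEuclideanCLM (𝕜 := ℝ) A‖

/-- Condition number `κ(A) = ‖A‖·‖A⁻¹‖` with respect to the spectral norm. -/
noncomputable def condNum {n : ℕ} (A : Matrix (Fin n) (Fin n) ℝ) : ℝ :=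
  opnorm A * opnorm A⁻¹


theorem vnorm_mulVec_le {n : ℕ} (A : Matrix (Fin n) (Fin n) ℝ) (v : Fin n → ℝ) :
    vnorm (A *ᵥ v) ≤ opnorm A * vnorm v := by
  simpa [vnorm, opnorm] using
    (Matrix.toEuclideanCLM (𝕜 := ℝ) A).le_opNorm (WithLp.toLp 2 v)

theorem opnorm_mul_le {n : ℕ} (A B : Matrix (Fin n) (Fin n) ℝ) :
    opnorm (A * B) ≤ opnorm A * opnorm B := by
  unfold opnorm
  rw [map_mul]
  exact norm_mul_le _ _

theorem vnorm_sub_le {n : ℕ} (v w : Fin n → ℝ) : vnorm (v - w) ≤ vnorm v + vnorm w :=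
  norm_sub_le (WithLp.toLp 2 v) (WithLp.toLp 2 w)

theorem vnorm_nonneg {n : ℕ} (v : Fin n → ℝ) : 0 ≤ vnorm v :=
  norm_nonneg _

theorem opnorm_nonneg {n : ℕ} (A : Matrix (Fin n) (Fin n) ℝ) : 0 ≤ opnorm A :=
  norm_nonneg _

theorem stmt15 {n : ℕ} (M K A : Matrix (Fin n) (Fin n) ℝ)
    (hM : IsUnit M) (hAdef : A = M + K) (hA : IsUnit A)
    (b : Fin n → ℝ) (hb : b ≠ 0)
    (x : Fin n → ℝ) (hx : x = A⁻¹.mulVec b)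
    (B : Matrix (Fin n) (Fin n) ℝ) (hBdef : B = 1 + M⁻¹ * K)
    (c : Fin n → ℝ) (hc : c = M⁻¹.mulVec b)
    (ε : ℝ) (hε : 0 ≤ ε) (xL : Fin n → ℝ)
    (hres : vnorm (c - B.mulVec xL) ≤
      ε * (opnorm B * vnorm xL + 2 * opnorm M⁻¹ * opnorm K * vnorm xL))
    (hres2 : vnorm (b - A.mulVec xL) ≤ vnorm b) :
    vnorm (x - xL) ≤
      2 * ε * condNum B * (1 + 2 * opnorm A⁻¹ * opnorm K) *
        (opnorm A⁻¹ * vnorm b) := by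
  have hM_det := (Matrix.isUnit_iff_isUnit_det M).mp hM
  have hA_det := (Matrix.isUnit_iff_isUnit_det A).mp hA
  have hBA : B = M⁻¹ * A := by
    rw [hBdef, hAdef, mul_add, Matrix.nonsing_inv_mul M hM_det]
  have hB_det : IsUnit B.det := by
    rw [hBA, Matrix.det_mul]
    exact (Matrix.isUnit_nonsing_inv_det M hM_det).mul hA_det
  have hMinv : M⁻¹ = B * A⁻¹ := by
    rw [hBA, Matrix.mul_nonsing_inv_cancel_right A M⁻¹ hA_det]
  have h_err : x - xL = B⁻¹ *ᵥ (c - B *ᵥ xL) := by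
    rw [Matrix.mulVec_sub, Matrix.mulVec_mulVec, Matrix.nonsing_inv_mul B hB_det,
      Matrix.one_mulVec, hc, hMinv, Matrix.mulVec_mulVec,
      Matrix.nonsing_inv_mul_cancel_left B A⁻¹ hB_det, hx]
  have hxL : vnorm xL ≤ 2 * (opnorm A⁻¹ * vnorm b) := by
    have h_sol : xL = A⁻¹ *ᵥ (b - (b - A *ᵥ xL)) := by
      rw [sub_sub_cancel, Matrix.mulVec_mulVec, Matrix.nonsing_inv_mul A hA_det,
        Matrix.one_mulVec]
    have h_bound : vnorm xL ≤ opnorm A⁻¹ * vnorm (b - (b - A *ᵥ xL)) := by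
      conv_lhs => rw [h_sol]
      exact vnorm_mulVec_le _ _
    have h_rhs := vnorm_sub_le b (b - A *ᵥ xL)
    calc vnorm xL ≤ opnorm A⁻¹ * vnorm (b - (b - A *ᵥ xL)) := h_bound
      _ ≤ opnorm A⁻¹ * (2 * vnorm b) :=
        mul_le_mul_of_nonneg_left (by linarith) (opnorm_nonneg _)
      _ = 2 * (opnorm A⁻¹ * vnorm b) := by ring
  have hMinv_le : opnorm M⁻¹ ≤ opnorm B * opnorm A⁻¹ := by
    rw [hMinv]
    exact opnorm_mul_le _ _
  have hA0 := opnorm_nonneg A⁻¹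
  have hB0 := opnorm_nonneg B
  have hBinv0 := opnorm_nonneg B⁻¹
  have hK0 := opnorm_nonneg K
  have hxL0 := vnorm_nonneg xL
  calc vnorm (x - xL) ≤ opnorm B⁻¹ * vnorm (c - B *ᵥ xL) := by
        rw [h_err]
        exact vnorm_mulVec_le _ _
    _ ≤ opnorm B⁻¹ *
          (ε * (opnorm B * vnorm xL + 2 * opnorm M⁻¹ * opnorm K * vnorm xL)) := by gcongr
    _ ≤ opnorm B⁻¹ * (ε * (opnorm B * vnorm xL +
          2 * (opnorm B * opnorm A⁻¹) * opnorm K * vnorm xL)) := by gcongr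
    _ = ε * condNum B * (1 + 2 * opnorm A⁻¹ * opnorm K) * vnorm xL := by
        unfold condNum
        ring
    _ ≤ ε * condNum B * (1 + 2 * opnorm A⁻¹ * opnorm K) *
          (2 * (opnorm A⁻¹ * vnorm b)) := by
        have h_cond : 0 ≤ condNum B := mul_nonneg hB0 hBinv0
        gcongr
    _ = 2 * ε * condNum B * (1 + 2 * opnorm A⁻¹ * opnorm K) *
          (opnorm A⁻¹ * vnorm b) := by ring
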